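/- Let G = (V,E) be a connected, non-bipartite cubic graph and let T_V and T_E be the two rooted binary trees on a common taxon set constructed from G with parameter M = 36|E| + 8|V| as described. Then d^2_MP(T_V, T_E) = |V| + 5|E| + 12M + MAXCUT(G), where MAXCUT(G) is the maximum, over all partitions of V into two disjoint parts V1 and V2, of the number of edges of G with one endpoint in V1 and one endpoint in V2. -/

import Mathlib

namespace MPDist

/-- A rooted binary phylogenetic tree: leaves are labelled by taxa,
every internal vertex (including the root) has exactly two children. -/
inductive PTree (X : Type) : Type
  | leaf : X → PTree X
  | node : PTree X → PTree X → PTree X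

namespace PTree

/-- The list of leaf labels (taxa) of a tree. -/
def leaves {X : Type} : PTree X → List X
  | .leaf x => [x]
  | .node l r => l.leaves ++ r.leaves

/-- Relabelling of taxa. -/
def map {X Y : Type} (φ : X → Y) : PTree X → PTree Y
  | .leaf x => .leaf (φ x)
  | .node l r => .node (l.map φ) (r.map φ)

end PTree

/-- `T` is a phylogenetic tree on the taxon set `X`:
its leaves are bijectively labelled by the elements of `X`. -/
def IsPhylo {X : Type} (T : PTree X) : Prop :=
  T.leaves.Nodup ∧ ∀ x : X, x ∈ T.leaves

/-- A state-labelled binary tree (an extension assigns a state to every vertex). -/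
inductive ETree (C : Type) : Type
  | leaf : C → ETree C
  | node : C → ETree C → ETree C → ETree C

namespace ETree

/-- The state at the root. -/
def root {C : Type} : ETree C → C
  | .leaf c => c
  | .node c _ _ => c

/-- The number of edges `{u,v}` with different states at the two endpoints
(substitutions/mutations). -/
def changes {C : Type} [DecidableEq C] : ETree C → ℕ
  | .leaf _ => 0
  | .node c l r =>
      ((if l.root = c then 0 else 1) + (if r.root = c then 0 else 1)) +
        (l.changes + r.changes)

end ETree

/-- `g` is an extension of the character `f` to the tree `T`: it has the same
shape as `T`, assigns a state to every vertex, and agrees with `f` on the taxa. -/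
inductive IsExtension {X C : Type} (f : X → C) : PTree X → ETree C → Prop
  | leaf (x : X) : IsExtension f (.leaf x) (.leaf (f x))
  | node {l r : PTree X} {gl gr : ETree C} (c : C) :
      IsExtension f l gl → IsExtension f r gr →
      IsExtension f (.node l r) (.node c gl gr)

/-- The parsimony score `l_f(T)`: the minimum number of mutation edges
over all extensions of `f` to `T`. -/
noncomputable def pscore {X C : Type} [DecidableEq C] (f : X → C) (T : PTree X) : ℕ :=
  sInf { k : ℕ | ∃ g : ETree C, IsExtension f T g ∧ g.changes = k }

/-- The MP distance `d_MP(T1,T2) = max_f |l_f(T1) − l_f(T2)|`, the maximum taken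
over all characters `f` on the taxon set (states drawn from `ℕ`). -/
noncomputable def dMP {X : Type} (T1 T2 : PTree X) : ℕ :=
  sSup { k : ℕ | ∃ f : X → ℕ, k = ((pscore f T1 : ℤ) - (pscore f T2 : ℤ)).natAbs }

/-- `d^i_MP(T1,T2)`: as `dMP`, but over characters using at most `i` states. -/
noncomputable def dMPk {X : Type} (i : ℕ) (T1 T2 : PTree X) : ℕ :=
  sSup { k : ℕ | ∃ f : X → Fin i, k = ((pscore f T1 : ℤ) - (pscore f T2 : ℤ)).natAbs }

/-- `max_f (l_f(T2) − l_f(T1))` over all characters `f`. -/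
noncomputable def maxDiff {X : Type} (T1 T2 : PTree X) : ℤ :=
  sSup { d : ℤ | ∃ f : X → ℕ, d = (pscore f T2 : ℤ) - (pscore f T1 : ℤ) }

/-- `max_f (l_f(T2) − l_f(T1))` over all characters `f` with at most `i` states. -/
noncomputable def maxDiffk {X : Type} (i : ℕ) (T1 T2 : PTree X) : ℤ :=
  sSup { d : ℤ | ∃ f : X → Fin i, d = (pscore f T2 : ℤ) - (pscore f T1 : ℤ) }

/-- `gap(T1,T2) = |max_f(l_f(T2)−l_f(T1)) − max_f(l_f(T1)−l_f(T2))|`. -/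
noncomputable def gap {X : Type} (T1 T2 : PTree X) : ℤ :=
  |maxDiff T1 T2 - maxDiff T2 T1|

/-- `gap` restricted to characters with at most `i` states. -/
noncomputable def gapk {X : Type} (i : ℕ) (T1 T2 : PTree X) : ℤ :=
  |maxDiffk i T1 T2 - maxDiffk i T2 T1|

/-- `s` occurs as a (rooted) subtree of `t`. -/
inductive IsSubtree {X : Type} : PTree X → PTree X → Prop
  | refl (t : PTree X) : IsSubtree t t
  | left {s l r : PTree X} : IsSubtree s l → IsSubtree s (.node l r)
  | right {s l r : PTree X} : IsSubtree s r → IsSubtree s (.node l r)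

/-- Taxa `a`, `b` form a cherry of `T`: they are leaves with a common parent. -/
def IsCherry {X : Type} (T : PTree X) (a b : X) : Prop :=
  IsSubtree (.node (.leaf a) (.leaf b)) T

/-- Relabel a tree on taxa `ℕ` by shifting all labels up by `s` (fresh copies). -/
def shiftT (s : ℕ) (T : PTree ℕ) : PTree ℕ := T.map (fun x => x + s)

/-- `T_a = (((((2,3),4),5),6),1)` on taxa `{1,…,6}` (taxon `j` encoded as `j-1`). -/
def Ta6 : PTree ℕ :=
  .node (.node (.node (.node (.node (.leaf 1) (.leaf 2)) (.leaf 3)) (.leaf 4)) (.leaf 5)) (.leaf 0)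

/-- `T_b = ((((2,6),(3,4)),5),1)` on taxa `{1,…,6}` (taxon `j` encoded as `j-1`). -/
def Tb6 : PTree ℕ :=
  .node (.node (.node (.node (.leaf 1) (.leaf 5)) (.node (.leaf 2) (.leaf 3))) (.leaf 4)) (.leaf 0)

/-- `T_A`: two disjoint copies of `T_a` joined under a new root (12 taxa). -/
def TA12 : PTree ℕ := .node Ta6 (shiftT 6 Ta6)

/-- `T_B`: two disjoint copies of `T_b` joined under a new root (12 taxa). -/
def TB12 : PTree ℕ := .node Tb6 (shiftT 6 Tb6)

/-- `TkA k` is the tree `T^{k+1}_A`: `k+1` disjoint copies of `T_A` arranged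
along a caterpillar backbone (so `TkA 0 = T^1_A = T_A`). -/
def TkA : ℕ → PTree ℕ
  | 0 => TA12
  | k+1 => .node (TkA k) (shiftT (12*(k+1)) TA12)

/-- `TkB k` is the tree `T^{k+1}_B`. -/
def TkB : ℕ → PTree ℕ
  | 0 => TB12
  | k+1 => .node (TkB k) (shiftT (12*(k+1)) TB12)

/-- `T_a = (((5,(6,4)),3),((1,(8,2)),7))` on taxa `{1,…,8}` (taxon `j` encoded as `j-1`). -/
def Ta8 : PTree ℕ :=
  .node (.node (.node (.leaf 4) (.node (.leaf 5) (.leaf 3))) (.leaf 2))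
        (.node (.node (.leaf 0) (.node (.leaf 7) (.leaf 1))) (.leaf 6))

/-- `T_b = (((7,((4,2),6)),3),(8,(1,5)))` on taxa `{1,…,8}` (taxon `j` encoded as `j-1`). -/
def Tb8 : PTree ℕ :=
  .node (.node (.node (.leaf 6) (.node (.node (.leaf 3) (.leaf 1)) (.leaf 5))) (.leaf 2))
        (.node (.leaf 7) (.node (.leaf 0) (.leaf 4)))

/-- `T_A` (2-state construction): two disjoint copies of `T_a` under a new root (16 taxa). -/
def TA16 : PTree ℕ := .node Ta8 (shiftT 8 Ta8)

/-- `T_B` (2-state construction): two disjoint copies of `T_b` under a new root (16 taxa). -/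
def TB16 : PTree ℕ := .node Tb8 (shiftT 8 Tb8)

/-- `T_AA`: two disjoint copies of `T_A` under a new root (32 taxa). -/
def TAA : PTree ℕ := .node TA16 (shiftT 16 TA16)

/-- `T_BB`: two disjoint copies of `T_B` under a new root (32 taxa). -/
def TBB : PTree ℕ := .node TB16 (shiftT 16 TB16)

/-- `TkAA k` is the tree `T^{k+1}_AA` (so `TkAA 0 = T^1_AA = T_AA`). -/
def TkAA : ℕ → PTree ℕ
  | 0 => TAA
  | k+1 => .node (TkAA k) (shiftT (32*(k+1)) TAA)

/-- `TkBB k` is the tree `T^{k+1}_BB`. -/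
def TkBB : ℕ → PTree ℕ
  | 0 => TBB
  | k+1 => .node (TkBB k) (shiftT (32*(k+1)) TBB)


/-! ### The construction of `T_E` and `T_V` from a cubic graph `G = (V,E)`.

The graph has vertex set `{0,…,n-1}` and edge set `{0,…,m-1}`; `ends e` gives
the two (distinct) endpoints of edge `e`.  The taxa of the constructed trees
are encoded as natural numbers:
* `0 … 32M-1` : the taxa of `S_V = T^M_AA` and `S_E = T^M_BB`;
* `xTax M ends e u = 32M + 2e + side` : the taxon `x_e[u]` for `u` an endpoint
  of `e` (`side = 0/1` according to whether `u` is the first or second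
  endpoint of `e`);
* `wTax M m i j = 32M + 2m + 4i + j` : the taxon `w_i^{j+2}` (`j = 0,1,2,3`
  encodes `w_i^2, w_i^3, w_i^4, w_i^5`);
* `gTax M m i g = 32M + 6m + 4i + g` : the taxa `α_i, β_i, γ_i, δ_i`
  (`g = 0,1,2,3`). -/

/-- The taxon `x_e[u]`. -/
def xTax (M : ℕ) (ends : ℕ → ℕ × ℕ) (e u : ℕ) : ℕ :=
  32*M + 2*e + (if (ends e).1 = u then 0 else 1)

/-- The taxon `w_i^{j+2}` for `j = 0,1,2,3`. -/
def wTax (M m i j : ℕ) : ℕ := 32*M + 2*m + 4*i + j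

/-- The taxa `α_i, β_i, γ_i, δ_i` for `g = 0,1,2,3`. -/
def gTax (M m i g : ℕ) : ℕ := 32*M + 6*m + 4*i + g

/-- `S_V = T^M_AA`. -/
def SV (M : ℕ) : PTree ℕ := TkAA (M - 1)

/-- `S_E = T^M_BB`. -/
def SE (M : ℕ) : PTree ℕ := TkBB (M - 1)

/-- A binary tree shape whose leaves are labelled by `Option ℕ` (`none` is the
leaf that will be replaced by `S_E`, `some e` the leaf that will be replaced by
the cherry of edge `e`) and whose internal nodes are labelled by `ℕ`
(the enumeration `w_1,…,w_{|E|}` of the internal nodes). -/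
inductive LTree : Type
  | leaf : Option ℕ → LTree
  | node : ℕ → LTree → LTree → LTree

/-- The list of leaf labels of an `LTree`. -/
def LTree.leafLabels : LTree → List (Option ℕ)
  | .leaf x => [x]
  | .node _ l r => l.leafLabels ++ r.leafLabels

/-- The list of internal-node labels of an `LTree`. -/
def LTree.nodeLabels : LTree → List ℕ
  | .leaf _ => []
  | .node i l r => i :: (l.nodeLabels ++ r.nodeLabels)

/-- Expansion of the tree shape into the subtree `T` of `T_E`: the leaf `none`
becomes `S_E`, the leaf `some e` becomes the cherry `(x_e[u], x_e[v])` on the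
endpoints `u,v` of `e`, and every internal node `w_i` becomes the gadget
`D(w_i) = (w_i^2,((w_i^0,w_i^4),(w_i^3,(w_i^5,w_i^1))))`, where `w_i^0` and
`w_i^1` are identified with the expansions of the two children of `w_i`. -/
def expandT (M m : ℕ) (ends : ℕ → ℕ × ℕ) : LTree → PTree ℕ
  | .leaf none => SE M
  | .leaf (some e) =>
      .node (.leaf (xTax M ends e (ends e).1)) (.leaf (xTax M ends e (ends e).2))
  | .node i l r =>
      .node (.leaf (wTax M m i 0))
        (.node (.node (expandT M m ends l) (.leaf (wTax M m i 2)))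
               (.node (.leaf (wTax M m i 1))
                      (.node (.leaf (wTax M m i 3)) (expandT M m ends r))))

/-- The double cherry `((α_i,γ_i),(β_i,δ_i))`. -/
def dCherry (M m i : ℕ) : PTree ℕ :=
  .node (.node (.leaf (gTax M m i 0)) (.leaf (gTax M m i 2)))
        (.node (.leaf (gTax M m i 1)) (.leaf (gTax M m i 3)))

/-- The rooted caterpillar whose leaves, from the bottom up, are
`h 0, h 1, …, h k`. -/
def catm (h : ℕ → PTree ℕ) : ℕ → PTree ℕ
  | 0 => h 0
  | k+1 => .node (catm h k) (h (k+1))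

/-- The tree `T_E`: the expanded tree `T` joined under a new root with the
caterpillar `T'` of the `n + 3m` double cherries, arranged according to the
bijection `σ'`. -/
def TEtree (n m M : ℕ) (ends : ℕ → ℕ × ℕ) (shape : LTree) (σ' : ℕ → ℕ) : PTree ℕ :=
  .node (expandT M m ends shape)
        (catm (fun j => dCherry M m (σ' j)) (n + 3*m - 1))

/-- The rooted triplet `(x_e[u],(x_{e*}[u],x_{e**}[u]))` for the vertex `u`,
where `(e,e*,e**) = inc u` are the three edges incident to `u`. -/
def vTriplet (M : ℕ) (ends : ℕ → ℕ × ℕ) (inc : ℕ → ℕ × ℕ × ℕ) (u : ℕ) : PTree ℕ :=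
  .node (.leaf (xTax M ends (inc u).1 u))
    (.node (.leaf (xTax M ends (inc u).2.1 u)) (.leaf (xTax M ends (inc u).2.2 u)))

/-- The canonical enumeration of the collection `J` of `1 + n + 3m` pendant
trees of `T_V`: index `0` is `S_V`; indices `1,…,n` are the vertex triplets;
after that, each edge-gadget index `i < m` contributes the single-taxon trees
`w_i^4`, `w_i^5` and the cherry `(w_i^2, w_i^3)`. -/
def Jtree (n m M : ℕ) (ends : ℕ → ℕ × ℕ) (inc : ℕ → ℕ × ℕ × ℕ) (j : ℕ) : PTree ℕ :=
  if j = 0 then SV M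
  else if j ≤ n then vTriplet M ends inc (j - 1)
  else
    if (j - n - 1) % 3 = 0 then .leaf (wTax M m ((j - n - 1) / 3) 2)
    else if (j - n - 1) % 3 = 1 then .leaf (wTax M m ((j - n - 1) / 3) 3)
    else .node (.leaf (wTax M m ((j - n - 1) / 3) 0)) (.leaf (wTax M m ((j - n - 1) / 3) 1))

/-- The cherry switch with index `i` placed on an edge of the path `K`: the
edge is subdivided twice, the pendant cherry `(α_i,β_i)` hangs from one
subdivision vertex and `(γ_i,δ_i)` from the other; `t` is what is below. -/
def cSwitch (M m i : ℕ) (t : PTree ℕ) : PTree ℕ :=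
  .node (.node (.leaf (gTax M m i 0)) (.leaf (gTax M m i 1)))
    (.node (.node (.leaf (gTax M m i 2)) (.leaf (gTax M m i 3))) t)

/-- The caterpillar of `T_V`, built bottom-up: position `p` of the caterpillar
carries the pendant tree `Jtree (τ p)`, and the `j`-th edge (bottom-up) of the
root-to-cherry-leaf path `K` carries the cherry switch with index `σ j`. -/
def buildTV (n m M : ℕ) (ends : ℕ → ℕ × ℕ) (inc : ℕ → ℕ × ℕ × ℕ)
    (σ τ : ℕ → ℕ) : ℕ → PTree ℕ
  | 0 => .node (cSwitch M m (σ 0) (Jtree n m M ends inc (τ 0)))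
               (Jtree n m M ends inc (τ 1))
  | j+1 => .node (cSwitch M m (σ (j+1)) (buildTV n m M ends inc σ τ j))
                 (Jtree n m M ends inc (τ (j+2)))

/-- The tree `T_V` (there are `n + 3m` edges on the path `K`). -/
def TVtree (n m M : ℕ) (ends : ℕ → ℕ × ℕ) (inc : ℕ → ℕ × ℕ × ℕ)
    (σ τ : ℕ → ℕ) : PTree ℕ :=
  buildTV n m M ends inc σ τ (n + 3*m - 1)

/-- The graph `G` as a `SimpleGraph` on `Fin n`. -/
def Ggraph (n m : ℕ) (ends : ℕ → ℕ × ℕ) : SimpleGraph (Fin n) :=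
  SimpleGraph.fromRel (fun u v => ∃ e < m, ends e = (u.val, v.val))

/-- `MAXCUT(G)`: the maximum, over all partitions of the vertex set into two
parts (given by `c : ℕ → Bool`), of the number of edges with one endpoint in
each part. -/
noncomputable def maxcut (m : ℕ) (ends : ℕ → ℕ × ℕ) : ℕ :=
  sSup { k : ℕ | ∃ c : ℕ → Bool,
    k = ((Finset.range m).filter (fun e => c (ends e).1 ≠ c (ends e).2)).card }


/-- Costs of the two (capped) root states. -/
def cst (f : ℕ → Fin 2) : PTree ℕ → ℕ × ℕ
  | .leaf x => (if f x = 0 then 0 else 1, if f x = 0 then 1 else 0)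
  | .node l r =>
      (min ((cst f l).1 + (cst f r).1) ((cst f l).2 + (cst f r).2 + 1),
       min ((cst f l).2 + (cst f r).2) ((cst f l).1 + (cst f r).1 + 1))

def mn (f : ℕ → Fin 2) (T : PTree ℕ) : ℕ := min (cst f T).1 (cst f T).2
def mx (f : ℕ → Fin 2) (T : PTree ℕ) : ℕ := max (cst f T).1 (cst f T).2

theorem cst_near (f : ℕ → Fin 2) (T : PTree ℕ) :
    (cst f T).1 ≤ (cst f T).2 + 1 ∧ (cst f T).2 ≤ (cst f T).1 + 1 := by
  cases T with
  | leaf x => simp only [cst]; split_ifs <;> omega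
  | node l r => simp only [cst]; omega

theorem fin2 (c : Fin 2) : c = 0 ∨ c = 1 := by omega

theorem cst_lower (f : ℕ → Fin 2) (T : PTree ℕ) (g : ETree (Fin 2)) (h : IsExtension f T g) :
    (cst f T).1 ≤ g.changes + (if g.root = 0 then 0 else 1) ∧
    (cst f T).2 ≤ g.changes + (if g.root = 1 then 0 else 1) := by
  induction h with
  | leaf x =>
    rcases fin2 (f x) with h | h <;> simp [cst, ETree.changes, ETree.root, h]
  | @node l r gl gr c hl hr ihl ihr =>
    have hr : (ETree.node c gl gr).root = c := rfl
    simp only [cst, ETree.changes, hr]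
    rcases fin2 c with h | h <;> rcases fin2 gl.root with h1 | h1 <;>
      rcases fin2 gr.root with h2 | h2 <;> simp [h, h1, h2] at ihl ihr ⊢ <;> omega

theorem cst_upper (f : ℕ → Fin 2) (T : PTree ℕ) :
    (∃ g, IsExtension f T g ∧ g.changes + (if g.root = 0 then 0 else 1) = (cst f T).1) ∧
    (∃ g, IsExtension f T g ∧ g.changes + (if g.root = 1 then 0 else 1) = (cst f T).2) := by
  induction T with
  | leaf x =>
    refine ⟨⟨_, .leaf x, ?_⟩, ⟨_, .leaf x, ?_⟩⟩ <;>
    rcases fin2 (f x) with h | h <;> simp [cst, ETree.changes, ETree.root, h]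
  | node l r ihl ihr =>
    obtain ⟨⟨l0, hl0, el0⟩, ⟨l1, hl1, el1⟩⟩ := ihl
    obtain ⟨⟨r0, hr0, er0⟩, ⟨r1, hr1, er1⟩⟩ := ihr
    have k0 : (ETree.node 0 l0 r0).changes = (cst f l).1 + (cst f r).1 := by
      simp only [ETree.changes]; omega
    have k1 : (ETree.node 1 l1 r1).changes = (cst f l).2 + (cst f r).2 := by
      simp only [ETree.changes]; omega
    have e0 : IsExtension f (.node l r) (ETree.node 0 l0 r0) := .node 0 hl0 hr0
    have e1 : IsExtension f (.node l r) (ETree.node 1 l1 r1) := .node 1 hl1 hr1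
    constructor
    · by_cases h : (cst f l).1 + (cst f r).1 ≤ (cst f l).2 + (cst f r).2 + 1
      · exact ⟨_, e0, by rw [k0]; simp [cst, ETree.root]; omega⟩
      · exact ⟨_, e1, by rw [k1]; simp [cst, ETree.root]; omega⟩
    · by_cases h : (cst f l).2 + (cst f r).2 ≤ (cst f l).1 + (cst f r).1 + 1
      · exact ⟨_, e1, by rw [k1]; simp [cst, ETree.root]; omega⟩
      · exact ⟨_, e0, by rw [k0]; simp [cst, ETree.root]; omega⟩

theorem pscore_eq (f : ℕ → Fin 2) (T : PTree ℕ) : pscore f T = mn f T := by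
  have key : IsLeast { k : ℕ | ∃ g : ETree (Fin 2), IsExtension f T g ∧ g.changes = k } (mn f T) := by
    have lb : ∀ g, IsExtension f T g → mn f T ≤ g.changes := by
      intro g hg
      have h := cst_lower f T g hg
      unfold mn
      rcases fin2 g.root with h1 | h1 <;> simp [h1] at h <;> omega
    constructor
    · obtain ⟨⟨l0, hl0, el0⟩, ⟨l1, hl1, el1⟩⟩ := cst_upper f T
      have := lb _ hl0
      have := lb _ hl1
      by_cases h : (cst f T).1 ≤ (cst f T).2
      · refine ⟨l0, hl0, ?_⟩
        unfold mn at *; omega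
      · refine ⟨l1, hl1, ?_⟩
        unfold mn at *; omega
    · rintro k ⟨g, hg, rfl⟩
      exact lb g hg
  exact key.csInf_eq

theorem mn_le_mx (f T) : mn f T ≤ mx f T := by unfold mn mx; omega
theorem mx_le_mn (f T) : mx f T ≤ mn f T + 1 := by
  have := cst_near f T; unfold mn mx; omega
theorem mn_node (f l r) : mn f l + mn f r ≤ mn f (.node l r) := by
  unfold mn; simp only [cst]; omega
theorem mx_node (f l r) : mx f (.node l r) ≤ mx f l + mx f r := by
  unfold mx; simp only [cst]; omega
theorem mn_node_le (f l r) : mn f (.node l r) ≤ mn f l + mx f r := by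
  unfold mn mx; simp only [cst]; omega
theorem mn_leaf (f x) : mn f (.leaf x) = 0 := by
  unfold mn; simp only [cst]; split_ifs <;> rfl
theorem mx_leaf (f x) : mx f (.leaf x) = 1 := by
  unfold mx; simp only [cst]; split_ifs <;> rfl

theorem cst_map (f : ℕ → Fin 2) (φ : ℕ → ℕ) (T : PTree ℕ) :
    cst f (T.map φ) = cst (fun x => f (φ x)) T := by
  induction T with
  | leaf x => rfl
  | node l r ihl ihr => simp only [PTree.map, cst, ihl, ihr]

theorem mn_shift (f s T) : mn f (shiftT s T) = mn (fun x => f (x + s)) T := by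
  unfold mn shiftT; rw [cst_map]
theorem mx_shift (f s T) : mx f (shiftT s T) = mx (fun x => f (x + s)) T := by
  unfold mx shiftT; rw [cst_map]

theorem cst_congr (f f' : ℕ → Fin 2) (T : PTree ℕ) (h : ∀ y ∈ T.leaves, f y = f' y) :
    cst f T = cst f' T := by
  induction T with
  | leaf x => simp only [cst, h x (by simp [PTree.leaves])]
  | node l r ihl ihr =>
    simp only [PTree.leaves, List.mem_append] at h
    simp only [cst, ihl (fun y hy => h y (Or.inl hy)), ihr (fun y hy => h y (Or.inr hy))]

theorem base_all : ∀ a b c d e f g h : Fin 2,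
    let F : ℕ → Fin 2 := fun i => match i with
      | 0 => a | 1 => b | 2 => c | 3 => d | 4 => e | 5 => f | 6 => g | _ => h
    max (cst F Tb8).1 (cst F Tb8).2 ≤ min (cst F Ta8).1 (cst F Ta8).2 + 3 ∧
    min (cst F Ta8).1 (cst F Ta8).2 ≤ min (cst F Tb8).1 (cst F Tb8).2 + 2 := by
  decide +kernel

theorem base8 (f : ℕ → Fin 2) : mx f Tb8 ≤ mn f Ta8 + 3 ∧ mn f Ta8 ≤ mn f Tb8 + 2 := by
  have h := base_all (f 0) (f 1) (f 2) (f 3) (f 4) (f 5) (f 6) (f 7)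
  simp only at h
  unfold mx mn
  have ha := cst_congr f (fun i => match i with
      | 0 => f 0 | 1 => f 1 | 2 => f 2 | 3 => f 3 | 4 => f 4 | 5 => f 5 | 6 => f 6 | _ => f 7) Ta8
    (by intro y hy
        simp only [Ta8, PTree.leaves, List.mem_append, List.mem_singleton] at hy
        rcases hy with (((rfl|rfl|rfl)|rfl)|((rfl|rfl|rfl)|rfl)) <;> rfl)
  have hb := cst_congr f (fun i => match i with
      | 0 => f 0 | 1 => f 1 | 2 => f 2 | 3 => f 3 | 4 => f 4 | 5 => f 5 | 6 => f 6 | _ => f 7) Tb8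
    (by intro y hy
        simp only [Tb8, PTree.leaves, List.mem_append, List.mem_singleton] at hy
        rcases hy with (((rfl|((rfl|rfl)|rfl))|rfl)|(rfl|rfl|rfl)) <;> rfl)
  rw [ha, hb]
  exact h

theorem pair_save (f l r) (a b : ℕ) (h1 : mn f l ≤ a) (h2 : mn f r ≤ b) :
    mx f (.node l r) ≤ a + b + 1 := by
  have := cst_near f l
  have := cst_near f r
  unfold mn at *; unfold mx; simp only [cst]; omega

theorem baseAA (f : ℕ → Fin 2) : mx f TBB ≤ mn f TAA + 12 ∧ mx f TAA ≤ mn f TBB + 10 := by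
  have h16 : ∀ f : ℕ → Fin 2, mx f TB16 ≤ mn f TA16 + 6 ∧ mx f TA16 ≤ mn f TB16 + 5 := by
    intro f
    have h1 := base8 f
    have h2 := base8 (fun x => f (x + 8))
    have h3 := mx_node f Tb8 (shiftT 8 Tb8)
    have h4 := mn_node f Tb8 (shiftT 8 Tb8)
    have h5 := mn_node f Ta8 (shiftT 8 Ta8)
    rw [← mn_shift, ← mx_shift, ← mn_shift] at h2
    have h6 := pair_save f Ta8 (shiftT 8 Ta8) _ _ h1.2 h2.2
    unfold TB16 TA16
    omega
  have h1 := h16 f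
  have h2 := h16 (fun x => f (x + 16))
  rw [← mn_shift, ← mx_shift, ← mn_shift, ← mx_shift] at h2
  have h3 := mx_node f TB16 (shiftT 16 TB16)
  have h4 := mn_node f TB16 (shiftT 16 TB16)
  have h5 := mn_node f TA16 (shiftT 16 TA16)
  have h6 := mx_node f TA16 (shiftT 16 TA16)
  unfold TBB TAA
  omega

theorem baseK (f : ℕ → Fin 2) (k : ℕ) :
    mx f (TkBB k) ≤ mn f (TkAA k) + 12 * (k + 1) ∧
    mx f (TkAA k) ≤ mn f (TkBB k) + 10 * (k + 1) := by
  induction k with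
  | zero => have := baseAA f; unfold TkBB TkAA; omega
  | succ k ih =>
    have h2 := baseAA (fun x => f (x + 32 * (k + 1)))
    rw [← mn_shift, ← mx_shift, ← mn_shift, ← mx_shift] at h2
    have h3 := mx_node f (TkBB k) (shiftT (32 * (k + 1)) TBB)
    have h4 := mn_node f (TkBB k) (shiftT (32 * (k + 1)) TBB)
    have h5 := mn_node f (TkAA k) (shiftT (32 * (k + 1)) TAA)
    have h6 := mx_node f (TkAA k) (shiftT (32 * (k + 1)) TAA)
    unfold TkBB TkAA
    omega

/-- The extremal pattern on 8 taxa. -/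
def pat (y : ℕ) : Fin 2 := if 2 ≤ y % 8 ∧ y % 8 < 6 then 1 else 0

theorem pat8 : cst pat Ta8 = (1, 1) ∧ cst pat Tb8 = (4, 4) := by decide +kernel

theorem pat32 : cst pat TAA = (4, 4) ∧ cst pat TBB = (16, 16) := by decide +kernel

theorem leaves_map (φ : ℕ → ℕ) (T : PTree ℕ) : (T.map φ).leaves = T.leaves.map φ := by
  induction T with
  | leaf x => rfl
  | node l r ihl ihr => simp only [PTree.map, PTree.leaves, ihl, ihr, List.map_append]

theorem leaves_AA : (∀ y ∈ TAA.leaves, y < 32) ∧ (∀ y ∈ TBB.leaves, y < 32) := by decide +kernel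

theorem leaves_K (k : ℕ) : (∀ y ∈ (TkAA k).leaves, y < 32 * (k + 1)) ∧
    (∀ y ∈ (TkBB k).leaves, y < 32 * (k + 1)) := by
  induction k with
  | zero => exact leaves_AA
  | succ k ih =>
    constructor
    · intro y hy
      simp only [TkAA, PTree.leaves, shiftT, leaves_map, List.mem_append, List.mem_map] at hy
      rcases hy with hy | ⟨z, hz, rfl⟩
      · have := ih.1 y hy; omega
      · have := leaves_AA.1 z hz; omega
    · intro y hy
      simp only [TkBB, PTree.leaves, shiftT, leaves_map, List.mem_append, List.mem_map] at hy
      rcases hy with hy | ⟨z, hz, rfl⟩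
      · have := ih.2 y hy; omega
      · have := leaves_AA.2 z hz; omega

theorem patK (k : ℕ) : cst pat (TkAA k) = (4 * (k + 1), 4 * (k + 1)) ∧
    cst pat (TkBB k) = (16 * (k + 1), 16 * (k + 1)) := by
  have hs : (fun x => pat (x + 32 * (k + 1))) = pat := by
    funext x; unfold pat
    have : (x + 32 * (k + 1)) % 8 = x % 8 := by omega
    rw [this]
  induction k with
  | zero => exact pat32
  | succ k ih =>
    have hs : (fun x => pat (x + 32 * (k + 1))) = pat := by
      funext x; unfold pat
      have : (x + 32 * (k + 1)) % 8 = x % 8 := by omega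
      rw [this]
    have ih := ih hs
    simp only [TkAA, TkBB, cst, shiftT, cst_map, hs, ih.1, ih.2, pat32.1, pat32.2]
    constructor <;> ext <;> simp <;> omega

def nd (p q : ℕ × ℕ) : ℕ × ℕ :=
  (min (p.1 + q.1) (p.2 + q.2 + 1), min (p.2 + q.2) (p.1 + q.1 + 1))
def mnp (p : ℕ × ℕ) : ℕ := min p.1 p.2
def Sa (k : ℕ) : ℕ × ℕ := (k, k + 1)
def Sm (k : ℕ) : ℕ × ℕ := (k, k)
def Sb (k : ℕ) : ℕ × ℕ := (k + 1, k)

theorem nd_aa (i j : ℕ) : nd (Sa i) (Sa j) = Sa (i + j) := by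
  unfold nd Sa; ext <;> simp <;> omega
theorem nd_am (i j : ℕ) : nd (Sa i) (Sm j) = Sa (i + j) := by
  unfold nd Sa Sm; ext <;> simp <;> omega
theorem nd_ab (i j : ℕ) : nd (Sa i) (Sb j) = Sm (i + j + 1) := by
  unfold nd Sa Sb Sm; ext <;> simp <;> omega
theorem nd_ma (i j : ℕ) : nd (Sm i) (Sa j) = Sa (i + j) := by
  unfold nd Sa Sm; ext <;> simp <;> omega
theorem nd_mm (i j : ℕ) : nd (Sm i) (Sm j) = Sm (i + j) := by
  unfold nd Sm; ext <;> simp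
theorem nd_mb (i j : ℕ) : nd (Sm i) (Sb j) = Sb (i + j) := by
  unfold nd Sb Sm; ext <;> simp <;> omega
theorem nd_ba (i j : ℕ) : nd (Sb i) (Sa j) = Sm (i + j + 1) := by
  unfold nd Sa Sb Sm; ext <;> simp <;> omega
theorem nd_bm (i j : ℕ) : nd (Sb i) (Sm j) = Sb (i + j) := by
  unfold nd Sb Sm; ext <;> simp <;> omega
theorem nd_bb (i j : ℕ) : nd (Sb i) (Sb j) = Sb (i + j) := by
  unfold nd Sb; ext <;> simp <;> omega
theorem mnp_a (i : ℕ) : mnp (Sa i) = i := by unfold mnp Sa; simp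
theorem mnp_m (i : ℕ) : mnp (Sm i) = i := by unfold mnp Sm; simp
theorem mnp_b (i : ℕ) : mnp (Sb i) = i := by unfold mnp Sb; simp

theorem cst_cases (f : ℕ → Fin 2) (T : PTree ℕ) :
    ∃ k, cst f T = Sa k ∨ cst f T = Sm k ∨ cst f T = Sb k := by
  have h := cst_near f T
  refine ⟨min (cst f T).1 (cst f T).2, ?_⟩
  unfold Sa Sm Sb
  have c : (cst f T).1 < (cst f T).2 ∨ (cst f T).1 = (cst f T).2 ∨ (cst f T).2 < (cst f T).1 := by
    omega
  rcases c with c | c | c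
  · left; ext <;> simp <;> omega
  · right; left; ext <;> simp <;> omega
  · right; right; ext <;> simp <;> omega

theorem cst_node (f : ℕ → Fin 2) (l r : PTree ℕ) : cst f (.node l r) = nd (cst f l) (cst f r) := rfl
theorem mn_eq (f : ℕ → Fin 2) (T : PTree ℕ) : mn f T = mnp (cst f T) := rfl
theorem cst_leaf (f : ℕ → Fin 2) (x : ℕ) :
    cst f (.leaf x) = if f x = 0 then Sa 0 else Sb 0 := by
  simp only [cst, Sa, Sb]; split_ifs <;> rfl

def gad (w0 w1 : PTree ℕ) (a2 a3 a4 a5 : ℕ) : PTree ℕ :=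
  .node (.leaf a2) (.node (.node w0 (.leaf a4)) (.node (.leaf a3) (.node (.leaf a5) w1)))

theorem gadget_up (f : ℕ → Fin 2) (w0 w1 : PTree ℕ) (a2 a3 a4 a5 : ℕ) :
    mn f (gad w0 w1 a2 a3 a4 a5) ≤ mn f w0 + mn f w1 + 2 + (if f a2 = f a3 then 0 else 1) := by
  obtain ⟨k0, n0⟩ := cst_cases f w0
  obtain ⟨k1, n1⟩ := cst_cases f w1
  unfold gad
  rcases fin2 (f a2) with h2 | h2 <;> rcases fin2 (f a3) with h3 | h3 <;>
    rcases fin2 (f a4) with h4 | h4 <;> rcases fin2 (f a5) with h5 | h5 <;>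
    simp only [h2, h3, h4, h5, mn_eq, cst_node, cst_leaf, if_true, one_ne_zero, zero_ne_one, if_false] <;>
    rcases n0 with n0 | n0 | n0 <;> rcases n1 with n1 | n1 | n1 <;>
    simp only [n0, n1, nd_aa, nd_am, nd_ab, nd_ma, nd_mm, nd_mb, nd_ba, nd_bm, nd_bb,
      mnp_a, mnp_m, mnp_b] <;> omega

theorem gadget_low (f : ℕ → Fin 2) (w0 w1 : PTree ℕ) (a2 a3 a4 a5 : ℕ)
    (h4 : f a4 = if (cst f w0).1 < (cst f w0).2 then 1 else 0)
    (h5 : f a5 = if (cst f w1).1 < (cst f w1).2 then 1 else 0)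
    (h3 : f a3 = 1)
    (h2 : f a2 = if (cst f w0).1 ≠ (cst f w0).2 ∧ (cst f w1).1 ≠ (cst f w1).2 then 0 else 1) :
    mn f w0 + mn f w1 + 2 + (if f a2 = f a3 then 0 else 1) ≤ mn f (gad w0 w1 a2 a3 a4 a5) := by
  obtain ⟨k0, n0⟩ := cst_cases f w0
  obtain ⟨k1, n1⟩ := cst_cases f w1
  unfold gad
  rcases n0 with n0 | n0 | n0 <;> rcases n1 with n1 | n1 | n1 <;>
    rw [n0] at h4 h2 <;> rw [n1] at h5 h2 <;> simp [Sa, Sb, Sm] at h2 h4 h5 <;>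
    simp only [h2, h3, h4, h5, mn_eq, cst_node, cst_leaf, if_true, one_ne_zero, zero_ne_one, if_false,
      n0, n1, nd_aa, nd_am, nd_ab, nd_ma, nd_mm, nd_mb, nd_ba, nd_bm, nd_bb,
      mnp_a, mnp_m, mnp_b] <;> omega

theorem triplet_low (f : ℕ → Fin 2) (a b c : ℕ) :
    (if f a = f b ∧ f b = f c then 0 else 1) ≤
      mn f (.node (.leaf a) (.node (.leaf b) (.leaf c))) := by
  unfold mn
  simp only [cst]
  rcases fin2 (f a) with h2 | h2 <;> rcases fin2 (f b) with h3 | h3 <;>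
    rcases fin2 (f c) with h4 | h4 <;> simp [h2, h3, h4]

theorem triplet_const (f : ℕ → Fin 2) (a b c : ℕ) (h1 : f a = f b) (h2 : f b = f c) :
      mn f (.node (.leaf a) (.node (.leaf b) (.leaf c))) = 0 := by
  unfold mn
  simp only [cst]
  rcases fin2 (f c) with h4 | h4 <;> simp [h1, h2, h4]

theorem cherry_eq (f : ℕ → Fin 2) (a b : ℕ) :
    mn f (.node (.leaf a) (.leaf b)) = if f a = f b then 0 else 1 := by
  unfold mn
  simp only [cst]
  rcases fin2 (f a) with h2 | h2 <;> rcases fin2 (f b) with h3 | h3 <;> simp [h2, h3]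

/-- cost charged to the switch `i` -/
def Kc (f : ℕ → Fin 2) (a b c d : ℕ) : ℕ :=
  if f a = f b then (if f c = f d then (if f a = f c then 0 else 1) else 1)
  else (if f c = f d then 1 else 2)

theorem dch_up (f : ℕ → Fin 2) (a b c d : ℕ) :
    mx f (.node (.node (.leaf a) (.leaf c)) (.node (.leaf b) (.leaf d))) ≤ 1 + Kc f a b c d := by
  unfold mx Kc
  simp only [cst]
  rcases fin2 (f a) with h2 | h2 <;> rcases fin2 (f b) with h3 | h3 <;>
    rcases fin2 (f c) with h4 | h4 <;> rcases fin2 (f d) with h5 | h5 <;> simp [h2, h3, h4, h5]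

theorem dch_low (f : ℕ → Fin 2) (a b c d : ℕ) (h1 : f a ≠ f c) (h2 : f b ≠ f d) :
    2 ≤ mn f (.node (.node (.leaf a) (.leaf c)) (.node (.leaf b) (.leaf d))) := by
  have := mn_node f (.node (.leaf a) (.leaf c)) (.node (.leaf b) (.leaf d))
  rw [cherry_eq, cherry_eq, if_neg h1, if_neg h2] at this
  exact this

theorem sw_low (f : ℕ → Fin 2) (a b c d : ℕ) (t : PTree ℕ) :
    mn f t + Kc f a b c d ≤
      mn f (.node (.node (.leaf a) (.leaf b)) (.node (.node (.leaf c) (.leaf d)) t)) := by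
  obtain ⟨k0, n0⟩ := cst_cases f t
  unfold Kc
  rcases fin2 (f a) with h2 | h2 <;> rcases fin2 (f b) with h3 | h3 <;>
    rcases fin2 (f c) with h4 | h4 <;> rcases fin2 (f d) with h5 | h5 <;>
    simp only [h2, h3, h4, h5, mn_eq, cst_node, cst_leaf, if_true, one_ne_zero, zero_ne_one, if_false] <;>
    rcases n0 with n0 | n0 | n0 <;>
    simp only [n0, nd_aa, nd_am, nd_ab, nd_ma, nd_mm, nd_mb, nd_ba, nd_bm, nd_bb,
      mnp_a, mnp_m, mnp_b] <;> omega

theorem sw_up (f : ℕ → Fin 2) (a b c d : ℕ) (t J : PTree ℕ)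
    (h1 : f a = f b) (h2 : f c = f d) (h3 : f a ≠ f c)
    (h : f a = if (cst f J).1 ≤ (cst f J).2 then 0 else 1) :
    mn f (.node (.node (.node (.leaf a) (.leaf b)) (.node (.node (.leaf c) (.leaf d)) t)) J) ≤
      mn f t + mn f J + 1 := by
  have := cst_near f t
  have := cst_near f J
  unfold mn
  simp only [cst]
  generalize (cst f t).1 = A0 at *
  generalize (cst f t).2 = B0 at *
  generalize (cst f J).1 = A1 at *
  generalize (cst f J).2 = B1 at *
  rw [h1] at h h3
  rw [h2] at h3
  by_cases c0 : A1 ≤ B1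
  · rw [if_pos c0] at h
    rcases fin2 (f d) with h5 | h5 <;> simp [h, h5] at h3
    simp [h1, h2, h, h5]; omega
  · rw [if_neg c0] at h
    rcases fin2 (f d) with h5 | h5 <;> simp [h, h5] at h3
    simp [h1, h2, h, h5]; omega

def Wv (M m : ℕ) (f : ℕ → Fin 2) (i : ℕ) : ℕ :=
  if f (wTax M m i 0) = f (wTax M m i 1) then 0 else 1

def Ev (M : ℕ) (ends : ℕ → ℕ × ℕ) (f : ℕ → Fin 2) (e : ℕ) : ℕ :=
  if f (xTax M ends e (ends e).1) = f (xTax M ends e (ends e).2) then 0 else 1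

def Lv (M : ℕ) (ends : ℕ → ℕ × ℕ) (f : ℕ → Fin 2) : Option ℕ → ℕ
  | none => mn f (SE M)
  | some e => Ev M ends f e

def tot (M m : ℕ) (ends : ℕ → ℕ × ℕ) (f : ℕ → Fin 2) (t : LTree) : ℕ :=
  (t.leafLabels.map (Lv M ends f)).sum + (t.nodeLabels.map (fun i => 2 + Wv M m f i)).sum

theorem tot_node (M m : ℕ) (ends : ℕ → ℕ × ℕ) (f : ℕ → Fin 2) (i : ℕ) (l r : LTree) :
    tot M m ends f (.node i l r) = tot M m ends f l + tot M m ends f r + (2 + Wv M m f i) := by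
  simp only [tot, LTree.leafLabels, LTree.nodeLabels, List.map_append, List.sum_append,
    List.map_cons, List.sum_cons]
  omega

theorem tot_leaf (M m : ℕ) (ends : ℕ → ℕ × ℕ) (f : ℕ → Fin 2) (x : Option ℕ) :
    tot M m ends f (.leaf x) = mn f (expandT M m ends (.leaf x)) := by
  cases x with
  | none => simp [tot, LTree.leafLabels, LTree.nodeLabels, Lv, expandT]
  | some e => simp [tot, LTree.leafLabels, LTree.nodeLabels, Lv, expandT, Ev, cherry_eq]

theorem expand_node (M m : ℕ) (ends : ℕ → ℕ × ℕ) (i : ℕ) (l r : LTree) :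
    expandT M m ends (.node i l r) = gad (expandT M m ends l) (expandT M m ends r)
      (wTax M m i 0) (wTax M m i 1) (wTax M m i 2) (wTax M m i 3) := rfl

theorem expand_up (M m : ℕ) (ends : ℕ → ℕ × ℕ) (f : ℕ → Fin 2) (t : LTree) :
    mn f (expandT M m ends t) ≤ tot M m ends f t := by
  induction t with
  | leaf x => rw [tot_leaf]
  | node i l r ihl ihr =>
    rw [tot_node, expand_node]
    have := gadget_up f (expandT M m ends l) (expandT M m ends r)
      (wTax M m i 0) (wTax M m i 1) (wTax M m i 2) (wTax M m i 3)
    unfold Wv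
    omega

theorem expand_SE (M m : ℕ) (ends : ℕ → ℕ × ℕ) (f : ℕ → Fin 2) (t : LTree)
    (h : none ∈ t.leafLabels) : mn f (SE M) ≤ mn f (expandT M m ends t) := by
  induction t with
  | leaf x =>
    simp only [LTree.leafLabels, List.mem_singleton] at h
    subst h
    simp [expandT]
  | node i l r ihl ihr =>
    simp only [LTree.leafLabels, List.mem_append] at h
    have h1 := mn_node f (.leaf (wTax M m i 0)) (.node (.node (expandT M m ends l) (.leaf (wTax M m i 2)))
               (.node (.leaf (wTax M m i 1))
                      (.node (.leaf (wTax M m i 3)) (expandT M m ends r))))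
    have h2 := mn_node f (.node (expandT M m ends l) (.leaf (wTax M m i 2)))
               (.node (.leaf (wTax M m i 1))
                      (.node (.leaf (wTax M m i 3)) (expandT M m ends r)))
    have h3 := mn_node f (expandT M m ends l) (.leaf (wTax M m i 2))
    have h4 := mn_node f (.leaf (wTax M m i 1))
                      (.node (.leaf (wTax M m i 3)) (expandT M m ends r))
    have h5 := mn_node f (.leaf (wTax M m i 3)) (expandT M m ends r)
    simp only [expandT]
    rcases h with h | h
    · have := ihl h; omega
    · have := ihr h; omega

theorem xTax_lt (M m : ℕ) (ends : ℕ → ℕ × ℕ) (e u : ℕ) (h : e < m) :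
    xTax M ends e u < 32 * M + 2 * m := by
  unfold xTax; split_ifs <;> omega

theorem SE_lt (M : ℕ) (hM : 1 ≤ M) : ∀ y ∈ (SE M).leaves, y < 32 * M := by
  intro y hy
  have := (leaves_K (M - 1)).2 y hy
  omega

theorem SV_lt (M : ℕ) (hM : 1 ≤ M) : ∀ y ∈ (SV M).leaves, y < 32 * M := by
  intro y hy
  have := (leaves_K (M - 1)).1 y hy
  omega

theorem expand_congr (M m : ℕ) (hM : 1 ≤ M) (ends : ℕ → ℕ × ℕ) (f f' : ℕ → Fin 2) (t : LTree)
    (h1 : ∀ y < 32 * M + 2 * m, f y = f' y)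
    (h2 : ∀ i ∈ t.nodeLabels, ∀ j < 4, f (wTax M m i j) = f' (wTax M m i j))
    (h3 : ∀ e, some e ∈ t.leafLabels → e < m) :
    cst f (expandT M m ends t) = cst f' (expandT M m ends t) ∧
      tot M m ends f t = tot M m ends f' t := by
  induction t with
  | leaf x =>
    rw [tot_leaf, tot_leaf, mn_eq, mn_eq]
    have : cst f (expandT M m ends (.leaf x)) = cst f' (expandT M m ends (.leaf x)) := by
      apply cst_congr
      intro y hy
      apply h1
      cases x with
      | none => have := SE_lt M hM y hy; omega
      | some e =>
        have he := h3 e (by simp [LTree.leafLabels])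
        simp only [expandT, PTree.leaves, List.mem_append, List.mem_singleton] at hy
        rcases hy with rfl | rfl <;> exact xTax_lt _ _ _ _ _ he
    rw [this]
    exact ⟨rfl, rfl⟩
  | node i l r ihl ihr =>
    simp only [LTree.leafLabels, LTree.nodeLabels, List.mem_append, List.mem_cons] at h2 h3
    obtain ⟨l1, l2⟩ := ihl (fun i hi => h2 i (Or.inr (Or.inl hi))) (fun e he => h3 e (Or.inl he))
    obtain ⟨r1, r2⟩ := ihr (fun i hi => h2 i (Or.inr (Or.inr hi))) (fun e he => h3 e (Or.inr he))
    have hi := h2 i (Or.inl rfl)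
    rw [tot_node, tot_node, l2, r2]
    simp only [expandT, cst, l1, r1, Wv, hi 0 (by omega), hi 1 (by omega), hi 2 (by omega),
      hi 3 (by omega), and_self]

theorem expand_low (M m : ℕ) (hM : 1 ≤ M) (ends : ℕ → ℕ × ℕ) (t : LTree) :
    t.nodeLabels.Nodup → (∀ e, some e ∈ t.leafLabels → e < m) → ∀ f0 : ℕ → Fin 2,
    ∃ f : ℕ → Fin 2, (∀ y < 32 * M + 2 * m, f y = f0 y) ∧
      (∀ i ∉ t.nodeLabels, ∀ j < 4, f (wTax M m i j) = f0 (wTax M m i j)) ∧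
      tot M m ends f t ≤ mn f (expandT M m ends t) := by
  induction t with
  | leaf x =>
    intro _ _ f0
    exact ⟨f0, fun _ _ => rfl, fun _ _ _ _ => rfl, by rw [tot_leaf]⟩
  | node i l r ihl ihr =>
    intro hn he f0
    simp only [LTree.leafLabels, LTree.nodeLabels, List.mem_append, List.nodup_cons,
      List.nodup_append] at hn he
    obtain ⟨hi, hnl, hnr, hlr⟩ := hn
    have hel : ∀ e, some e ∈ l.leafLabels → e < m := fun e h => he e (Or.inl h)
    have her : ∀ e, some e ∈ r.leafLabels → e < m := fun e h => he e (Or.inr h)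
    obtain ⟨f1, a1, b1, c1⟩ := ihl hnl hel f0
    obtain ⟨f2, a2, b2, c2⟩ := ihr hnr her f1
    let p := cst f2 (expandT M m ends l)
    let q := cst f2 (expandT M m ends r)
    let f3 : ℕ → Fin 2 := fun y =>
      if y = wTax M m i 0 then (if p.1 ≠ p.2 ∧ q.1 ≠ q.2 then 0 else 1)
      else if y = wTax M m i 1 then 1
      else if y = wTax M m i 2 then (if p.1 < p.2 then 1 else 0)
      else if y = wTax M m i 3 then (if q.1 < q.2 then 1 else 0)
      else f2 y
    have a3 : ∀ y < 32 * M + 2 * m, f3 y = f2 y := by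
      intro y hy
      have ne0 : y ≠ wTax M m i 0 := by unfold wTax; omega
      have ne1 : y ≠ wTax M m i 1 := by unfold wTax; omega
      have ne2 : y ≠ wTax M m i 2 := by unfold wTax; omega
      have ne3 : y ≠ wTax M m i 3 := by unfold wTax; omega
      simp only [f3, if_neg ne0, if_neg ne1, if_neg ne2, if_neg ne3]
    have b3 : ∀ k, k ≠ i → ∀ j < 4, f3 (wTax M m k j) = f2 (wTax M m k j) := by
      intro k hk j hj
      have ne0 : wTax M m k j ≠ wTax M m i 0 := by unfold wTax; omega
      have ne1 : wTax M m k j ≠ wTax M m i 1 := by unfold wTax; omega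
      have ne2 : wTax M m k j ≠ wTax M m i 2 := by unfold wTax; omega
      have ne3 : wTax M m k j ≠ wTax M m i 3 := by unfold wTax; omega
      simp only [f3, if_neg ne0, if_neg ne1, if_neg ne2, if_neg ne3]
    have eL := expand_congr M m hM ends f2 f1 l a2
      (fun k hk j hj => b2 k (fun hk' => hlr k hk k hk' rfl) j hj) hel
    have eL3 := expand_congr M m hM ends f3 f2 l a3
      (fun k hk j hj => b3 k (fun h => hi (Or.inl (h ▸ hk))) j hj) hel
    have eR3 := expand_congr M m hM ends f3 f2 r a3
      (fun k hk j hj => b3 k (fun h => hi (Or.inr (h ▸ hk))) j hj) her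
    refine ⟨f3, fun y hy => by rw [a3 y hy, a2 y hy, a1 y hy], ?_, ?_⟩
    · intro k hk j hj
      simp only [LTree.nodeLabels, List.mem_append, List.mem_cons, not_or] at hk
      rw [b3 k hk.1 j hj, b2 k hk.2.2 j hj, b1 k hk.2.1 j hj]
    · rw [tot_node, expand_node]
      have w0 : f3 (wTax M m i 0) = (if p.1 ≠ p.2 ∧ q.1 ≠ q.2 then 0 else 1) := by
        simp only [f3, if_true]
      have w1 : f3 (wTax M m i 1) = 1 := by
        simp [f3, wTax]
      have w2 : f3 (wTax M m i 2) = (if p.1 < p.2 then 1 else 0) := by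
        simp [f3, wTax]
      have w3 : f3 (wTax M m i 3) = (if q.1 < q.2 then 1 else 0) := by
        simp [f3, wTax]
      have g := gadget_low f3 (expandT M m ends l) (expandT M m ends r)
        (wTax M m i 0) (wTax M m i 1) (wTax M m i 2) (wTax M m i 3)
        (by rw [eL3.1]; exact w2) (by rw [eR3.1]; exact w3) w1 (by rw [eL3.1, eR3.1]; exact w0)
      have m1 : mn f3 (expandT M m ends l) = mn f1 (expandT M m ends l) := by
        rw [mn_eq, mn_eq, eL3.1, eL.1]
      have m2 : mn f3 (expandT M m ends r) = mn f2 (expandT M m ends r) := by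
        rw [mn_eq, mn_eq, eR3.1]
      rw [eL3.2, eR3.2, eL.2]
      unfold Wv
      omega

theorem tot_eq (M m : ℕ) (ends : ℕ → ℕ × ℕ) (f : ℕ → Fin 2) (shape : LTree)
    (hshapeLeafNodup : shape.leafLabels.Nodup)
    (hshapeLeaf : ∀ x : Option ℕ,
      x ∈ shape.leafLabels ↔ (x = none ∨ ∃ e < m, x = some e))
    (hshapeNodeNodup : shape.nodeLabels.Nodup)
    (hshapeNode : ∀ i : ℕ, i ∈ shape.nodeLabels ↔ i < m) :
    tot M m ends f shape = mn f (SE M) + ∑ e ∈ Finset.range m, Ev M ends f e +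
      (2 * m + ∑ i ∈ Finset.range m, Wv M m f i) := by
  unfold tot
  rw [← List.sum_toFinset _ hshapeLeafNodup, ← List.sum_toFinset _ hshapeNodeNodup]
  have h1 : shape.leafLabels.toFinset = insert none ((Finset.range m).image some) := by
    ext x; rw [List.mem_toFinset, hshapeLeaf]; simp [eq_comm]
  have h2 : shape.nodeLabels.toFinset = Finset.range m := by
    ext x; rw [List.mem_toFinset, hshapeNode]; simp
  rw [h1, h2, Finset.sum_insert (by simp), Finset.sum_image (by simp), Finset.sum_add_distrib]
  simp [Lv, mul_comm]

theorem reidx (N : ℕ) (σ : ℕ → ℕ) (h : Set.BijOn σ (Set.Iio N) (Set.Iio N)) (g : ℕ → ℕ) :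
    ∑ j ∈ Finset.range N, g (σ j) = ∑ j ∈ Finset.range N, g j := by
  refine Finset.sum_nbij σ ?_ ?_ ?_ (fun _ _ => rfl)
  · intro a ha
    have := h.1 (Finset.mem_range.1 ha : a ∈ Set.Iio N)
    exact Finset.mem_range.2 this
  · rw [Finset.coe_range]; exact h.2.1
  · rw [Finset.coe_range]; exact h.2.2

theorem catm_mx (f : ℕ → Fin 2) (h : ℕ → PTree ℕ) (k : ℕ) :
    mx f (catm h k) ≤ ∑ j ∈ Finset.range (k + 1), mx f (h j) := by
  induction k with
  | zero => simp [catm]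
  | succ k ih =>
    rw [Finset.sum_range_succ]
    have := mx_node f (catm h k) (h (k + 1))
    simp only [catm]; omega

theorem catm_mn (f : ℕ → Fin 2) (h : ℕ → PTree ℕ) (k : ℕ) :
    ∑ j ∈ Finset.range (k + 1), mn f (h j) ≤ mn f (catm h k) := by
  induction k with
  | zero => simp [catm]
  | succ k ih =>
    rw [Finset.sum_range_succ]
    have := mn_node f (catm h k) (h (k + 1))
    simp only [catm]; omega

def Kv (M m : ℕ) (f : ℕ → Fin 2) (i : ℕ) : ℕ :=
  Kc f (gTax M m i 0) (gTax M m i 1) (gTax M m i 2) (gTax M m i 3)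

section
variable (n m M : ℕ) (ends : ℕ → ℕ × ℕ) (inc : ℕ → ℕ × ℕ × ℕ) (σ τ : ℕ → ℕ) (f : ℕ → Fin 2)

theorem build_low (k : ℕ) :
    ∑ j ∈ Finset.range (k + 1), Kv M m f (σ j) +
      ∑ j ∈ Finset.range (k + 2), mn f (Jtree n m M ends inc (τ j)) ≤
    mn f (buildTV n m M ends inc σ τ k) := by
  induction k with
  | zero =>
    have h1 := sw_low f (gTax M m (σ 0) 0) (gTax M m (σ 0) 1) (gTax M m (σ 0) 2) (gTax M m (σ 0) 3)
      (Jtree n m M ends inc (τ 0))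
    have h2 := mn_node f (cSwitch M m (σ 0) (Jtree n m M ends inc (τ 0)))
      (Jtree n m M ends inc (τ 1))
    simp only [Finset.sum_range_succ, Finset.sum_range_zero, buildTV, Kv, zero_add]
    unfold cSwitch at *
    omega
  | succ k ih =>
    have h1 := sw_low f (gTax M m (σ (k+1)) 0) (gTax M m (σ (k+1)) 1) (gTax M m (σ (k+1)) 2)
      (gTax M m (σ (k+1)) 3) (buildTV n m M ends inc σ τ k)
    have h2 := mn_node f (cSwitch M m (σ (k+1)) (buildTV n m M ends inc σ τ k))
      (Jtree n m M ends inc (τ (k+2)))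
    rw [Finset.sum_range_succ, Finset.sum_range_succ _ (k+2)]
    simp only [buildTV, Kv] at *
    unfold cSwitch at *
    omega

theorem sw_mx (i : ℕ) (t : PTree ℕ) : mx f (cSwitch M m i t) ≤ mx f t + 4 := by
  unfold cSwitch
  have h1 := mx_node f (.node (.leaf (gTax M m i 0)) (.leaf (gTax M m i 1)))
    (.node (.node (.leaf (gTax M m i 2)) (.leaf (gTax M m i 3))) t)
  have h2 := mx_node f (.node (.leaf (gTax M m i 2)) (.leaf (gTax M m i 3))) t
  have h3 := mx_node f (.leaf (gTax M m i 2)) (.leaf (gTax M m i 3))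
  have h4 := mx_node f (.leaf (gTax M m i 0)) (.leaf (gTax M m i 1))
  simp only [mx_leaf] at h3 h4
  omega

theorem build_mx (k : ℕ) :
    mx f (buildTV n m M ends inc σ τ k) ≤
    4 * (k + 1) + ∑ j ∈ Finset.range (k + 2), mx f (Jtree n m M ends inc (τ j)) := by
  induction k with
  | zero =>
    have h1 := sw_mx m M f (σ 0) (Jtree n m M ends inc (τ 0))
    have h2 := mx_node f (cSwitch M m (σ 0) (Jtree n m M ends inc (τ 0)))
      (Jtree n m M ends inc (τ 1))
    simp only [Finset.sum_range_succ, Finset.sum_range_zero, buildTV, zero_add]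
    omega
  | succ k ih =>
    have h1 := sw_mx m M f (σ (k+1)) (buildTV n m M ends inc σ τ k)
    have h2 := mx_node f (cSwitch M m (σ (k+1)) (buildTV n m M ends inc σ τ k))
      (Jtree n m M ends inc (τ (k+2)))
    rw [Finset.sum_range_succ _ (k+2)]
    simp only [buildTV]
    omega

theorem build_up (k : ℕ)
    (h : ∀ j ≤ k, f (gTax M m (σ j) 0) = f (gTax M m (σ j) 1) ∧
      f (gTax M m (σ j) 2) = f (gTax M m (σ j) 3) ∧
      f (gTax M m (σ j) 0) ≠ f (gTax M m (σ j) 2) ∧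
      f (gTax M m (σ j) 0) = if (cst f (Jtree n m M ends inc (τ (j+1)))).1 ≤
        (cst f (Jtree n m M ends inc (τ (j+1)))).2 then 0 else 1) :
    mn f (buildTV n m M ends inc σ τ k) ≤
    (k + 1) + ∑ j ∈ Finset.range (k + 2), mn f (Jtree n m M ends inc (τ j)) := by
  induction k with
  | zero =>
    obtain ⟨a, b, c, d⟩ := h 0 le_rfl
    have h1 := sw_up f _ _ _ _ (Jtree n m M ends inc (τ 0)) _ a b c d
    simp only [Finset.sum_range_succ, Finset.sum_range_zero, buildTV, zero_add]
    unfold cSwitch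
    simp only [zero_add] at h1
    omega
  | succ k ih =>
    have ih := ih (fun j hj => h j (by omega))
    obtain ⟨a, b, c, d⟩ := h (k+1) le_rfl
    have h1 := sw_up f _ _ _ _ (buildTV n m M ends inc σ τ k) _ a b c d
    rw [Finset.sum_range_succ _ (k+2)]
    simp only [buildTV]
    unfold cSwitch
    simp only [add_assoc, Nat.reduceAdd] at *
    omega

theorem J0 : Jtree n m M ends inc 0 = SV M := by simp [Jtree]
theorem J1 (u : ℕ) (hu : u < n) : Jtree n m M ends inc (u + 1) = vTriplet M ends inc u := by
  simp [Jtree, Nat.succ_le_of_lt hu]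
theorem J2 (i : ℕ) : Jtree n m M ends inc (n + 1 + 3 * i) = .leaf (wTax M m i 2) := by
  unfold Jtree
  have e1 : (n + 1 + 3 * i - n - 1) % 3 = 0 := by omega
  have e2 : (n + 1 + 3 * i - n - 1) / 3 = i := by omega
  rw [if_neg (by omega), if_neg (by omega), if_pos e1, e2]
theorem J3 (i : ℕ) : Jtree n m M ends inc (n + 1 + 3 * i + 1) = .leaf (wTax M m i 3) := by
  unfold Jtree
  have e1 : (n + 1 + 3 * i + 1 - n - 1) % 3 = 1 := by omega
  have e2 : (n + 1 + 3 * i + 1 - n - 1) / 3 = i := by omega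
  rw [if_neg (by omega), if_neg (by omega), if_neg (by omega), if_pos e1, e2]
theorem J4 (i : ℕ) : Jtree n m M ends inc (n + 1 + 3 * i + 2) =
    .node (.leaf (wTax M m i 0)) (.leaf (wTax M m i 1)) := by
  unfold Jtree
  have e2 : (n + 1 + 3 * i + 2 - n - 1) / 3 = i := by omega
  rw [if_neg (by omega), if_neg (by omega), if_neg (by omega), if_neg (by omega), e2]

theorem Jsplit (h : ℕ → ℕ) : ∑ j ∈ Finset.range (n + 3 * m + 1), h j =
    h 0 + ∑ u ∈ Finset.range n, h (u + 1) +
      ∑ i ∈ Finset.range m, (h (n + 1 + 3 * i) + h (n + 1 + 3 * i + 1) + h (n + 1 + 3 * i + 2)) := by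
  induction m with
  | zero => simp [Finset.sum_range_succ', add_comm]
  | succ m ih =>
    rw [show n + 3 * (m + 1) + 1 = (n + 3 * m + 1) + 1 + 1 + 1 by ring]
    rw [Finset.sum_range_succ, Finset.sum_range_succ, Finset.sum_range_succ, ih,
      Finset.sum_range_succ _ m]
    rw [show n + 1 + 3 * m = n + 3 * m + 1 by ring]
    ring

/-- sum of a function of the pendant trees -/
theorem Jsum (φ : PTree ℕ → ℕ) (hτ : Set.BijOn τ (Set.Iio (n + 3*m + 1)) (Set.Iio (n + 3*m + 1))) :
    ∑ j ∈ Finset.range (n + 3 * m + 1), φ (Jtree n m M ends inc (τ j)) =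
    φ (SV M) + ∑ u ∈ Finset.range n, φ (vTriplet M ends inc u) +
      ∑ i ∈ Finset.range m, (φ (.leaf (wTax M m i 2)) + φ (.leaf (wTax M m i 3)) +
        φ (.node (.leaf (wTax M m i 0)) (.leaf (wTax M m i 1)))) := by
  rw [reidx (n + 3 * m + 1) τ hτ (fun j => φ (Jtree n m M ends inc j)), Jsplit]
  simp only [J0, J2, J3, J4]
  congr 2
  refine Finset.sum_congr rfl (fun u hu => ?_)
  rw [J1 n m M ends inc u (Finset.mem_range.1 hu)]

end

def maj (a b c : Fin 2) : Fin 2 := if a = b then a else c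

theorem le_maxcut (m : ℕ) (ends : ℕ → ℕ × ℕ) (c : ℕ → Bool) :
    ((Finset.range m).filter (fun e => c (ends e).1 ≠ c (ends e).2)).card ≤ maxcut m ends := by
  unfold maxcut
  apply le_csSup
  · refine ⟨m, ?_⟩
    rintro k ⟨c, rfl⟩
    exact (Finset.card_filter_le _ _).trans (by simp)
  · exact ⟨c, rfl⟩

theorem ex_maxcut (m : ℕ) (ends : ℕ → ℕ × ℕ) : ∃ c : ℕ → Bool, maxcut m ends =
    ((Finset.range m).filter (fun e => c (ends e).1 ≠ c (ends e).2)).card := by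
  have := Nat.sSup_mem (s := { k : ℕ | ∃ c : ℕ → Bool,
    k = ((Finset.range m).filter (fun e => c (ends e).1 ≠ c (ends e).2)).card })
    ⟨_, fun _ => true, rfl⟩ (by
      refine ⟨m, ?_⟩
      rintro k ⟨c, rfl⟩
      exact (Finset.card_filter_le _ _).trans (by simp))
  exact this

def Nv (M : ℕ) (ends : ℕ → ℕ × ℕ) (inc : ℕ → ℕ × ℕ × ℕ) (f : ℕ → Fin 2) (u : ℕ) : ℕ :=
  if f (xTax M ends (inc u).1 u) = f (xTax M ends (inc u).2.1 u) ∧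
     f (xTax M ends (inc u).2.1 u) = f (xTax M ends (inc u).2.2 u) then 0 else 1

def IncOk (n m : ℕ) (ends : ℕ → ℕ × ℕ) (inc : ℕ → ℕ × ℕ × ℕ) : Prop := ∀ u < n,
      (inc u).1 < m ∧ (inc u).2.1 < m ∧ (inc u).2.2 < m ∧
      (inc u).1 ≠ (inc u).2.1 ∧ (inc u).1 ≠ (inc u).2.2 ∧ (inc u).2.1 ≠ (inc u).2.2 ∧
      ((ends (inc u).1).1 = u ∨ (ends (inc u).1).2 = u) ∧
      ((ends (inc u).2.1).1 = u ∨ (ends (inc u).2.1).2 = u) ∧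
      ((ends (inc u).2.2).1 = u ∨ (ends (inc u).2.2).2 = u)

theorem maj_bound : ∀ a b c : Fin 2, (if a = maj a b c then 0 else 1) +
    ((if b = maj a b c then 0 else 1) + (if c = maj a b c then 0 else 1)) ≤
    (if a = b ∧ b = c then 0 else 1 : ℕ) := by decide

theorem col_eq : ∀ a b : Bool, (if (if a then (1:Fin 2) else 0) = (if b then 1 else 0)
    then 0 else 1 : ℕ) = if a ≠ b then 1 else 0 := by decide

theorem cut_bound (n m M : ℕ) (ends : ℕ → ℕ × ℕ)
    (hends : ∀ e < m, (ends e).1 < n ∧ (ends e).2 < n ∧ (ends e).1 ≠ (ends e).2)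
    (hcubic : ∀ v < n,
      ((Finset.range m).filter (fun e => (ends e).1 = v ∨ (ends e).2 = v)).card = 3)
    (inc : ℕ → ℕ × ℕ × ℕ) (hinc : IncOk n m ends inc) (f : ℕ → Fin 2) :
    ∑ e ∈ Finset.range m, Ev M ends f e ≤
      maxcut m ends + ∑ u ∈ Finset.range n, Nv M ends inc f u := by
  let cc : ℕ → Fin 2 := fun u => maj (f (xTax M ends (inc u).1 u)) (f (xTax M ends (inc u).2.1 u))
    (f (xTax M ends (inc u).2.2 u))
  let h : ℕ → ℕ → ℕ := fun e u => if f (xTax M ends e u) = cc u then 0 else 1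
  have h1 : ∀ e ∈ Finset.range m, Ev M ends f e ≤
      (if decide (cc (ends e).1 = 0) ≠ decide (cc (ends e).2 = 0) then 1 else 0) +
      ∑ u ∈ Finset.range n, if (ends e).1 = u ∨ (ends e).2 = u then h e u else 0 := by
    intro e he
    obtain ⟨e1, e2, e3⟩ := hends e (Finset.mem_range.1 he)
    have hs : ∑ u ∈ {(ends e).1, (ends e).2}, (if (ends e).1 = u ∨ (ends e).2 = u then h e u else 0)
        ≤ ∑ u ∈ Finset.range n, if (ends e).1 = u ∨ (ends e).2 = u then h e u else 0 := by
      apply Finset.sum_le_sum_of_subset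
      intro x hx
      simp only [Finset.mem_insert, Finset.mem_singleton] at hx
      rw [Finset.mem_range]
      rcases hx with rfl | rfl <;> assumption
    rw [Finset.sum_pair e3] at hs
    simp only [true_or, or_true, if_true] at hs
    refine le_trans ?_ (Nat.add_le_add_left hs _)
    simp only [h, Ev]
    generalize f (xTax M ends e (ends e).1) = a
    generalize f (xTax M ends e (ends e).2) = b
    generalize cc (ends e).1 = c
    generalize cc (ends e).2 = d
    revert a b c d
    decide
  have h2 := Finset.sum_le_sum h1
  rw [Finset.sum_add_distrib, Finset.sum_comm, ← Finset.card_filter] at h2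
  have h3 := le_maxcut m ends (fun u => decide (cc u = 0))
  have h4 : ∀ u ∈ Finset.range n, (∑ e ∈ Finset.range m,
      if (ends e).1 = u ∨ (ends e).2 = u then h e u else 0) ≤ Nv M ends inc f u := by
    intro u hu
    have hu := Finset.mem_range.1 hu
    obtain ⟨i1, i2, i3, d1, d2, d3, k1, k2, k3⟩ := hinc u hu
    rw [← Finset.sum_filter]
    have hf : (Finset.range m).filter (fun e => (ends e).1 = u ∨ (ends e).2 = u) =
        {(inc u).1, (inc u).2.1, (inc u).2.2} := by
      symm
      apply Finset.eq_of_subset_of_card_le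
      · intro x hx
        simp only [Finset.mem_insert, Finset.mem_singleton] at hx
        rw [Finset.mem_filter, Finset.mem_range]
        rcases hx with rfl | rfl | rfl
        · exact ⟨i1, k1⟩
        · exact ⟨i2, k2⟩
        · exact ⟨i3, k3⟩
      · rw [hcubic u hu, Finset.card_insert_of_notMem (by simp [d1, d2]), Finset.card_pair d3]
    rw [hf, Finset.sum_insert (by simp [d1, d2]), Finset.sum_pair d3]
    exact maj_bound _ _ _
  have h5 := Finset.sum_le_sum h4
  omega

section
variable (n m M : ℕ) (ends : ℕ → ℕ × ℕ) (inc : ℕ → ℕ × ℕ × ℕ) (σ τ σ' : ℕ → ℕ)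
  (shape : LTree)

theorem SVSE (hM : 1 ≤ M) (f : ℕ → Fin 2) : mx f (SE M) ≤ mn f (SV M) + 12 * M ∧
    mx f (SV M) ≤ mn f (SE M) + 10 * M := by
  have := baseK f (M - 1)
  rw [Nat.sub_add_cancel hM] at this
  exact this

theorem upper1 (hn : 1 ≤ n) (hM : 1 ≤ M)
    (hends : ∀ e < m, (ends e).1 < n ∧ (ends e).2 < n ∧ (ends e).1 ≠ (ends e).2)
    (hcubic : ∀ v < n,
      ((Finset.range m).filter (fun e => (ends e).1 = v ∨ (ends e).2 = v)).card = 3)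
    (hinc : IncOk n m ends inc)
    (hshapeLeafNodup : shape.leafLabels.Nodup)
    (hshapeLeaf : ∀ x : Option ℕ,
      x ∈ shape.leafLabels ↔ (x = none ∨ ∃ e < m, x = some e))
    (hshapeNodeNodup : shape.nodeLabels.Nodup)
    (hshapeNode : ∀ i : ℕ, i ∈ shape.nodeLabels ↔ i < m)
    (hσ : Set.BijOn σ (Set.Iio (n + 3*m)) (Set.Iio (n + 3*m)))
    (hτ : Set.BijOn τ (Set.Iio (n + 3*m + 1)) (Set.Iio (n + 3*m + 1)))
    (hσ' : Set.BijOn σ' (Set.Iio (n + 3*m)) (Set.Iio (n + 3*m)))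
    (f : ℕ → Fin 2) :
    mn f (TEtree n m M ends shape σ') ≤
      mn f (TVtree n m M ends inc σ τ) + (n + 5*m + 12*M + maxcut m ends) := by
  have a1 := mn_node_le f (expandT M m ends shape)
    (catm (fun j => dCherry M m (σ' j)) (n + 3*m - 1))
  have a2 := expand_up M m ends f shape
  rw [tot_eq M m ends f shape hshapeLeafNodup hshapeLeaf hshapeNodeNodup hshapeNode] at a2
  have a3 := catm_mx f (fun j => dCherry M m (σ' j)) (n + 3*m - 1)
  have hN : n + 3*m - 1 + 1 = n + 3*m := by omega
  rw [hN] at a3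
  rw [reidx _ σ' hσ' (fun j => mx f (dCherry M m j))] at a3
  have a4 : ∑ j ∈ Finset.range (n + 3*m), mx f (dCherry M m j) ≤
      ∑ j ∈ Finset.range (n + 3*m), (1 + Kv M m f j) :=
    Finset.sum_le_sum (fun j _ => dch_up f _ _ _ _)
  rw [Finset.sum_add_distrib, Finset.sum_const, Finset.card_range, smul_eq_mul, mul_one] at a4
  have b1 := build_low n m M ends inc σ τ f (n + 3*m - 1)
  rw [show n + 3*m - 1 + 2 = n + 3*m + 1 by omega, hN, reidx _ σ hσ (Kv M m f),
    Jsum n m M ends inc τ (mn f) hτ] at b1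
  simp only [mn_leaf, cherry_eq, zero_add] at b1
  have b2 : ∑ u ∈ Finset.range n, Nv M ends inc f u ≤
      ∑ u ∈ Finset.range n, mn f (vTriplet M ends inc u) :=
    Finset.sum_le_sum (fun j _ => triplet_low f _ _ _)
  have c1 := cut_bound n m M ends hends hcubic inc hinc f
  have c2 := SVSE M hM f
  have c3 := mn_le_mx f (SE M)
  unfold TEtree TVtree
  simp only [Wv] at a2
  omega

theorem upper2 (hn : 1 ≤ n) (hM : 1 ≤ M) (hMM : M = 36*m + 8*n)
    (hshapeLeaf : ∀ x : Option ℕ,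
      x ∈ shape.leafLabels ↔ (x = none ∨ ∃ e < m, x = some e))
    (hτ : Set.BijOn τ (Set.Iio (n + 3*m + 1)) (Set.Iio (n + 3*m + 1)))
    (f : ℕ → Fin 2) :
    mn f (TVtree n m M ends inc σ τ) ≤
      mn f (TEtree n m M ends shape σ') + (n + 5*m + 12*M + maxcut m ends) := by
  have a1 := mn_node f (expandT M m ends shape)
    (catm (fun j => dCherry M m (σ' j)) (n + 3*m - 1))
  have a2 := expand_SE M m ends f shape ((hshapeLeaf none).2 (Or.inl rfl))
  have b1 := build_mx n m M ends inc σ τ f (n + 3*m - 1)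
  rw [show n + 3*m - 1 + 2 = n + 3*m + 1 by omega,
    Jsum n m M ends inc τ (mx f) hτ] at b1
  have b2 : ∑ u ∈ Finset.range n, mx f (vTriplet M ends inc u) ≤ ∑ u ∈ Finset.range n, 3 := by
    refine Finset.sum_le_sum (fun u _ => ?_)
    unfold vTriplet
    have h1 := mx_node f (.leaf (xTax M ends (inc u).1 u))
      (.node (.leaf (xTax M ends (inc u).2.1 u)) (.leaf (xTax M ends (inc u).2.2 u)))
    have h2 := mx_node f (.leaf (xTax M ends (inc u).2.1 u)) (.leaf (xTax M ends (inc u).2.2 u))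
    simp only [mx_leaf] at h1 h2
    omega
  have b3 : ∑ i ∈ Finset.range m, (mx f (.leaf (wTax M m i 2)) + mx f (.leaf (wTax M m i 3)) +
        mx f (.node (.leaf (wTax M m i 0)) (.leaf (wTax M m i 1)))) ≤ ∑ i ∈ Finset.range m, 4 := by
    refine Finset.sum_le_sum (fun i _ => ?_)
    have h2 := mx_node f (.leaf (wTax M m i 0)) (.leaf (wTax M m i 1))
    simp only [mx_leaf] at h2 ⊢
    omega
  simp only [Finset.sum_const, Finset.card_range, smul_eq_mul] at b2 b3
  have c2 := SVSE M hM f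
  have c3 := mn_le_mx f (buildTV n m M ends inc σ τ (n + 3*m - 1))
  unfold TEtree TVtree
  omega

theorem J_lt (hM : 1 ≤ M) (hinc : IncOk n m ends inc) (j : ℕ) (hj : j < n + 3*m + 1) :
    ∀ y ∈ (Jtree n m M ends inc j).leaves, y < 32*M + 6*m := by
  intro y hy
  unfold Jtree at hy
  split_ifs at hy with h1 h2 h3 h4
  · have := SV_lt M hM y hy; omega
  · obtain ⟨i1, i2, i3, -⟩ := hinc (j - 1) (by omega)
    simp only [vTriplet, PTree.leaves, List.mem_append, List.mem_singleton] at hy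
    have x1 := xTax_lt M m ends _ (j-1) i1
    have x2 := xTax_lt M m ends _ (j-1) i2
    have x3 := xTax_lt M m ends _ (j-1) i3
    omega
  all_goals
    simp only [wTax, PTree.leaves, List.mem_append, List.mem_singleton] at hy
    omega

theorem lower (hn : 1 ≤ n) (hM : 1 ≤ M)
    (hends : ∀ e < m, (ends e).1 < n ∧ (ends e).2 < n ∧ (ends e).1 ≠ (ends e).2)
    (hinc : IncOk n m ends inc)
    (hshapeLeafNodup : shape.leafLabels.Nodup)
    (hshapeLeaf : ∀ x : Option ℕ,
      x ∈ shape.leafLabels ↔ (x = none ∨ ∃ e < m, x = some e))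
    (hshapeNodeNodup : shape.nodeLabels.Nodup)
    (hshapeNode : ∀ i : ℕ, i ∈ shape.nodeLabels ↔ i < m)
    (hσ : Set.BijOn σ (Set.Iio (n + 3*m)) (Set.Iio (n + 3*m)))
    (hτ : Set.BijOn τ (Set.Iio (n + 3*m + 1)) (Set.Iio (n + 3*m + 1))) :
    ∃ f : ℕ → Fin 2, mn f (TVtree n m M ends inc σ τ) + (n + 5*m + 12*M + maxcut m ends) ≤
      mn f (TEtree n m M ends shape σ') := by
  obtain ⟨c, hc⟩ := ex_maxcut m ends
  let col : ℕ → Fin 2 := fun u => if c u then 1 else 0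
  let f0 : ℕ → Fin 2 := fun y => if y < 32*M then pat y else
    if (y - 32*M) % 2 = 0 then col (ends ((y - 32*M)/2)).1 else col (ends ((y - 32*M)/2)).2
  obtain ⟨f1, p1, -, p3⟩ := expand_low M m hM ends shape hshapeNodeNodup
    (fun e he => by
      rcases (hshapeLeaf _).1 he with h | ⟨e', he', h⟩
      · simp at h
      · simp at h; omega) f0
  have hinv : ∀ i < n + 3*m, ∃ j < n + 3*m, σ j = i := fun i hi => by
    obtain ⟨j, hj, e⟩ := hσ.2.2 (show i ∈ Set.Iio (n + 3*m) from hi)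
    exact ⟨j, hj, e⟩
  choose! ρ hρ1 hρ2 using hinv
  let θ : ℕ → Fin 2 := fun i => if (cst f1 (Jtree n m M ends inc (τ (ρ i + 1)))).1 ≤
    (cst f1 (Jtree n m M ends inc (τ (ρ i + 1)))).2 then 0 else 1
  let f2 : ℕ → Fin 2 := fun y => if y < 32*M + 6*m then f1 y else
    if (y - (32*M + 6*m)) % 4 < 2 then θ ((y - (32*M + 6*m))/4) else 1 - θ ((y - (32*M + 6*m))/4)
  have q1 : ∀ y < 32*M + 6*m, f2 y = f1 y := fun y hy => by simp only [f2, if_pos hy]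
  have q2 : ∀ i, f2 (gTax M m i 0) = θ i ∧ f2 (gTax M m i 1) = θ i ∧
      f2 (gTax M m i 2) = 1 - θ i ∧ f2 (gTax M m i 3) = 1 - θ i := by
    intro i
    have key : ∀ g < 4, f2 (gTax M m i g) = if g < 2 then θ i else 1 - θ i := by
      intro g hg
      have e0 : ¬ gTax M m i g < 32*M + 6*m := by unfold gTax; omega
      have e1 : (gTax M m i g - (32*M + 6*m)) / 4 = i := by unfold gTax; omega
      have e2 : (gTax M m i g - (32*M + 6*m)) % 4 = g := by unfold gTax; omega
      simp only [f2, if_neg e0, e1, e2]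
    exact ⟨key 0 (by omega), key 1 (by omega), key 2 (by omega), key 3 (by omega)⟩
  have th : ∀ a : Fin 2, a ≠ 1 - a := by decide
  have hx : ∀ e < m, ∀ u, ((ends e).1 = u ∨ (ends e).2 = u) → f2 (xTax M ends e u) = col u := by
    intro e he u hu
    have hl := xTax_lt M m ends e u he
    rw [q1 _ (by omega), p1 _ hl]
    have e0 : ¬ xTax M ends e u < 32*M := by unfold xTax; omega
    have e1 : (xTax M ends e u - 32*M) / 2 = e := by unfold xTax; split_ifs <;> omega
    simp only [f0, if_neg e0, e1]
    by_cases h : (ends e).1 = u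
    · have e2 : (xTax M ends e u - 32*M) % 2 = 0 := by unfold xTax; rw [if_pos h]; omega
      rw [if_pos e2, h]
    · have e2 : ¬ (xTax M ends e u - 32*M) % 2 = 0 := by unfold xTax; rw [if_neg h]; omega
      rw [if_neg e2, hu.resolve_left h]
  have hpat : ∀ y < 32*M, f2 y = pat y := fun y hy => by
    rw [q1 _ (by omega), p1 _ (by omega)]
    simp only [f0, if_pos hy]
  have hK := patK (M - 1)
  rw [Nat.sub_add_cancel hM] at hK
  have sv : mn f2 (SV M) = 4 * M := by
    rw [mn_eq, cst_congr f2 pat _ (fun y hy => hpat y (SV_lt M hM y hy))]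
    unfold SV
    rw [hK.1]; simp [mnp]
  have se : mn f2 (SE M) = 16 * M := by
    rw [mn_eq, cst_congr f2 pat _ (fun y hy => hpat y (SE_lt M hM y hy))]
    unfold SE
    rw [hK.2]; simp [mnp]
  have eC := expand_congr M m hM ends f2 f1 shape (fun y hy => q1 y (by omega))
    (fun i hi j hj => q1 _ (by have := (hshapeNode i).1 hi; unfold wTax; omega))
    (fun e he => by
      rcases (hshapeLeaf _).1 he with h | ⟨e', he', h⟩
      · simp at h
      · simp at h; omega)
  rw [← eC.2, mn_eq, ← eC.1, ← mn_eq,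
    tot_eq M m ends f2 shape hshapeLeafNodup hshapeLeaf hshapeNodeNodup hshapeNode, se] at p3
  have cutE : ∑ e ∈ Finset.range m, Ev M ends f2 e = maxcut m ends := by
    rw [hc, Finset.card_filter]
    refine Finset.sum_congr rfl (fun e he => ?_)
    have he := Finset.mem_range.1 he
    unfold Ev
    rw [hx e he _ (Or.inl rfl), hx e he _ (Or.inr rfl)]
    exact col_eq _ _
  have hN : n + 3*m - 1 + 1 = n + 3*m := by omega
  have a1 := mn_node f2 (expandT M m ends shape)
    (catm (fun j => dCherry M m (σ' j)) (n + 3*m - 1))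
  have a3 := catm_mn f2 (fun j => dCherry M m (σ' j)) (n + 3*m - 1)
  rw [hN] at a3
  have a4 : ∑ j ∈ Finset.range (n + 3*m), 2 ≤
      ∑ j ∈ Finset.range (n + 3*m), mn f2 (dCherry M m (σ' j)) := by
    refine Finset.sum_le_sum (fun j _ => ?_)
    obtain ⟨g0, g1, g2, g3⟩ := q2 (σ' j)
    exact dch_low f2 _ _ _ _ (by rw [g0, g2]; exact th _) (by rw [g1, g3]; exact th _)
  rw [Finset.sum_const, Finset.card_range, smul_eq_mul] at a4
  have b1 := build_up n m M ends inc σ τ f2 (n + 3*m - 1) (by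
    intro j hj
    have hj : j < n + 3*m := by omega
    obtain ⟨g0, g1, g2, g3⟩ := q2 (σ j)
    have hσj : σ j < n + 3*m := hσ.1 (show j ∈ Set.Iio (n + 3*m) from hj)
    have hr : ρ (σ j) = j := hσ.2.1 (hρ1 _ hσj) hj (hρ2 _ hσj)
    have hτj : τ (j+1) < n + 3*m + 1 :=
      hτ.1 (show j + 1 ∈ Set.Iio (n + 3*m + 1) by simpa using hj)
    refine ⟨by rw [g0, g1], by rw [g2, g3], by rw [g0, g2]; exact th _, ?_⟩
    rw [g0, cst_congr f2 f1 _ (fun y hy => q1 y (J_lt n m M ends inc hM hinc _ hτj y hy))]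
    simp only [θ, hr])
  rw [show n + 3*m - 1 + 2 = n + 3*m + 1 by omega, hN,
    Jsum n m M ends inc τ (mn f2) hτ, sv] at b1
  simp only [mn_leaf, cherry_eq, zero_add] at b1
  have b2 : ∑ u ∈ Finset.range n, mn f2 (vTriplet M ends inc u) = 0 := by
    refine Finset.sum_eq_zero (fun u hu => ?_)
    obtain ⟨i1, i2, i3, -, -, -, k1, k2, k3⟩ := hinc u (Finset.mem_range.1 hu)
    exact triplet_const f2 _ _ _ (by rw [hx _ i1 _ k1, hx _ i2 _ k2])
      (by rw [hx _ i2 _ k2, hx _ i3 _ k3])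
  refine ⟨f2, ?_⟩
  unfold TEtree TVtree
  simp only [Wv] at p3
  omega

end

/-- for every connected non-bipartite cubic graph `G` and every
choice of the arbitrary data in the construction (with `M = 36|E| + 8|V|`),
`d^2_MP(T_V,T_E) = |V| + 5|E| + 12M + MAXCUT(G)`. -/
theorem dMP2_of_construction_eq_maxcut
    (n m M : ℕ)
    (hM : M = 36*m + 8*n)
    (ends : ℕ → ℕ × ℕ)
    -- the endpoints of each edge are two distinct vertices
    (hends : ∀ e < m, (ends e).1 < n ∧ (ends e).2 < n ∧ (ends e).1 ≠ (ends e).2)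
    -- the graph is simple: distinct edges have distinct (unordered) endpoint pairs
    (hsimple : ∀ e < m, ∀ e' < m, e ≠ e' →
      ends e ≠ ends e' ∧ ends e ≠ ((ends e').2, (ends e').1))
    -- the graph is cubic: every vertex lies on exactly 3 edges
    (hcubic : ∀ v < n,
      ((Finset.range m).filter (fun e => (ends e).1 = v ∨ (ends e).2 = v)).card = 3)
    -- the graph is connected and not bipartite
    (hconn : (Ggraph n m ends).Connected)
    (hnotbip : ¬ (Ggraph n m ends).Colorable 2)
    -- `inc u` lists the three (pairwise distinct) edges incident to vertex `u`
    (inc : ℕ → ℕ × ℕ × ℕ)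
    (hinc : ∀ u < n,
      (inc u).1 < m ∧ (inc u).2.1 < m ∧ (inc u).2.2 < m ∧
      (inc u).1 ≠ (inc u).2.1 ∧ (inc u).1 ≠ (inc u).2.2 ∧ (inc u).2.1 ≠ (inc u).2.2 ∧
      ((ends (inc u).1).1 = u ∨ (ends (inc u).1).2 = u) ∧
      ((ends (inc u).2.1).1 = u ∨ (ends (inc u).2.1).2 = u) ∧
      ((ends (inc u).2.2).1 = u ∨ (ends (inc u).2.2).2 = u))
    -- an arbitrary binary tree shape on `m+1` leaves: its leaves are labelled
    -- bijectively by `{none} ∪ {some e | e < m}` and its internal nodes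
    -- bijectively by `{0,…,m-1}`
    (shape : LTree)
    (hshapeLeafNodup : shape.leafLabels.Nodup)
    (hshapeLeaf : ∀ x : Option ℕ,
      x ∈ shape.leafLabels ↔ (x = none ∨ ∃ e < m, x = some e))
    (hshapeNodeNodup : shape.nodeLabels.Nodup)
    (hshapeNode : ∀ i : ℕ, i ∈ shape.nodeLabels ↔ i < m)
    -- arbitrary bijections: `σ` assigns switch indices to the `n+3m` edges of
    -- the path `K`, `τ` assigns the trees of `J` to the `n+3m+1` caterpillar
    -- leaves of `T_V`, and `σ'` assigns the double cherries to the `n+3m`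
    -- caterpillar leaves of `T'`
    (σ τ σ' : ℕ → ℕ)
    (hσ : Set.BijOn σ (Set.Iio (n + 3*m)) (Set.Iio (n + 3*m)))
    (hτ : Set.BijOn τ (Set.Iio (n + 3*m + 1)) (Set.Iio (n + 3*m + 1)))
    (hσ' : Set.BijOn σ' (Set.Iio (n + 3*m)) (Set.Iio (n + 3*m)))
    :
    dMPk 2 (TVtree n m M ends inc σ τ) (TEtree n m M ends shape σ') =
      n + 5*m + 12*M + maxcut m ends := by
  have hn : 1 ≤ n := by
    obtain ⟨v⟩ := hconn.nonempty
    have := v.2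
    omega
  have hM1 : 1 ≤ M := by omega
  obtain ⟨f, hf⟩ := lower n m M ends inc σ τ σ' shape hn hM1 hends hinc hshapeLeafNodup hshapeLeaf
    hshapeNodeNodup hshapeNode hσ hτ
  have u1 := upper1 n m M ends inc σ τ σ' shape hn hM1 hends hcubic hinc hshapeLeafNodup hshapeLeaf
    hshapeNodeNodup hshapeNode hσ hτ hσ'
  have u2 := upper2 n m M ends inc σ τ σ' shape hn hM1 hM hshapeLeaf hτ
  unfold dMPk
  apply IsGreatest.csSup_eq
  constructor
  · refine ⟨f, ?_⟩
    rw [pscore_eq, pscore_eq]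
    have := u1 f
    omega
  · rintro k ⟨g, rfl⟩
    rw [pscore_eq, pscore_eq]
    have := u1 g
    have := u2 g
    omega

end MPDist
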